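/- arXiv:1311.6742 — 5 statements merged into one kernel-verified Lean document; each statement's English description precedes it below -/
import Mathlib

section
/- Let n ≥ 3, let C ⊂ Alt(n) be the set of all 3-cycles in Sym(n), and let M be the operator on real-valued functions on Alt(n) given by (Mf)(x) = (1/|C|)·Σ_{c∈C} f(c⁻¹x). Then the spectral gap of M on L²(Alt(n)) equals exactly 3/(n−1); that is: (i) for every f : Alt(n) → ℝ with Σ_{x∈Alt(n)} f(x) = 0 one has ⟨Mf, f⟩ ≤ (1 − 3/(n−1))·‖f‖², and (ii) there exists a nonzero f : Alt(n) → ℝ with Σ_{x} f(x) = 0 and Mf = (1 − 3/(n−1))·f. -/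
open Equiv Finset
open scoped Classical

/-- The set `C` of all 3-cycles in `Sym(n)` (all of which lie in `Alt(n)`). -/
noncomputable def threeCycles (n : ℕ) : Finset (Perm (Fin n)) :=
  Finset.univ.filter (fun x => x.IsThreeCycle)

/-- The operator `M`: convolution with the uniform probability measure on the set of
3-cycles, `(Mf)(x) = (1/|C|)·∑_{c∈C} f(c⁻¹x)`. -/
noncomputable def cycleConv (n : ℕ) (f : Perm (Fin n) → ℝ) : Perm (Fin n) → ℝ :=
  fun x => (1 / ((threeCycles n).card : ℝ)) * ∑ c ∈ threeCycles n, f (c⁻¹ * x)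

section EvenPerms

variable {α : Type*} [Fintype α] [DecidableEq α]

/-- The even permutations supported in `S`. -/
def evenPerms (S : Finset α) : Finset (Perm α) :=
  univ.filter fun g => Perm.sign g = 1 ∧ g.support ⊆ S

/-- The 3-cycles supported in `S`. -/
noncomputable def threeCyclesOn (S : Finset α) : Finset (Perm α) :=
  univ.filter fun g => g.IsThreeCycle ∧ g.support ⊆ S

theorem mem_evenPerms {S : Finset α} {g : Perm α} :
    g ∈ evenPerms S ↔ Perm.sign g = 1 ∧ g.support ⊆ S := by
  simp [evenPerms]

theorem mem_threeCyclesOn {S : Finset α} {g : Perm α} :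
    g ∈ threeCyclesOn S ↔ g.IsThreeCycle ∧ g.support ⊆ S := by
  simp [threeCyclesOn]

theorem one_mem_evenPerms (S : Finset α) : (1 : Perm α) ∈ evenPerms S := by
  simp [mem_evenPerms]

theorem mul_mem_evenPerms {S : Finset α} {g h : Perm α} (hg : g ∈ evenPerms S)
    (hh : h ∈ evenPerms S) : g * h ∈ evenPerms S := by
  rw [mem_evenPerms] at *
  exact ⟨by simp [hg.1, hh.1], (Perm.support_mul_le g h).trans (union_subset hg.2 hh.2)⟩

theorem inv_mem_evenPerms {S : Finset α} {g : Perm α} (hg : g ∈ evenPerms S) :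
    g⁻¹ ∈ evenPerms S := by
  rw [mem_evenPerms] at *
  simpa using hg

theorem evenPerms_mono {S T : Finset α} (h : S ⊆ T) : evenPerms S ⊆ evenPerms T := by
  intro g hg
  rw [mem_evenPerms] at *
  exact ⟨hg.1, hg.2.trans h⟩

theorem mem_evenPerms_erase {S : Finset α} {i : α} {g : Perm α} :
    g ∈ evenPerms (S.erase i) ↔ g ∈ evenPerms S ∧ g i = i := by
  rw [mem_evenPerms, mem_evenPerms, subset_erase, Perm.notMem_support, and_assoc]

theorem card_evenPerms_pos (S : Finset α) : 0 < #(evenPerms S) :=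
  card_pos.2 ⟨1, one_mem_evenPerms S⟩

theorem apply_mem_of_mem_evenPerms {S : Finset α} {g : Perm α} (hg : g ∈ evenPerms S) {i : α}
    (hi : i ∈ S) : g i ∈ S := by
  by_cases h : g i = i
  · rwa [h]
  · exact (mem_evenPerms.1 hg).2 (Perm.apply_mem_support.2 (Perm.mem_support.2 h))

theorem exists_mem_evenPerms_apply_eq {S : Finset α} (hS : 3 ≤ #S) {j l : α} (hj : j ∈ S)
    (hl : l ∈ S) : ∃ t ∈ evenPerms S, t j = l := by
  by_cases hjl : j = l
  · exact ⟨1, one_mem_evenPerms S, by simp [hjl]⟩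
  have h1 : l ∈ S.erase j := mem_erase.2 ⟨Ne.symm hjl, hl⟩
  have h2 : 0 < #((S.erase j).erase l) := by
    rw [card_erase_of_mem h1, card_erase_of_mem hj]; omega
  obtain ⟨m, hm⟩ := card_pos.1 h2
  simp only [mem_erase] at hm
  obtain ⟨hml, hmj, hmS⟩ := hm
  refine ⟨swap j m * swap j l, mem_evenPerms.2 ⟨?_, fun x hx => ?_⟩, ?_⟩
  · simp [Perm.sign_swap hjl, Perm.sign_swap (Ne.symm hmj)]
  · by_contra hxS
    have e1 : x ≠ j := by rintro rfl; exact hxS hj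
    have e2 : x ≠ l := by rintro rfl; exact hxS hl
    have e3 : x ≠ m := by rintro rfl; exact hxS hmS
    simp [swap_apply_of_ne_of_ne, e1, e2, e3] at hx
  · simp [swap_apply_of_ne_of_ne (Ne.symm hjl) (Ne.symm hml)]

/-- Left multiplication by `a` maps the stabilizer of `j` onto the coset `{g | g j = a j}`. -/
theorem sum_evenPerms_erase_mul {M : Type*} [AddCommMonoid M] {S : Finset α} {a : Perm α}
    (ha : a ∈ evenPerms S) (j : α) (f : Perm α → M) :
    ∑ b ∈ evenPerms (S.erase j), f (a * b) = ∑ g ∈ evenPerms S with g j = a j, f g := by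
  refine sum_nbij' (fun b => a * b) (fun g => a⁻¹ * g) ?_ ?_ ?_ ?_ ?_
  · intro b hb
    rw [mem_evenPerms_erase] at hb
    simp [mul_mem_evenPerms ha hb.1, hb.2]
  · intro g hg
    rw [mem_filter] at hg
    rw [mem_evenPerms_erase]
    exact ⟨mul_mem_evenPerms (inv_mem_evenPerms ha) hg.1, by simp [hg.2]⟩
  all_goals simp

theorem sum_evenPerms_mul_left {M : Type*} [AddCommMonoid M] {S : Finset α} {a : Perm α}
    (ha : a ∈ evenPerms S) (f : Perm α → M) :
    ∑ b ∈ evenPerms S, f (a * b) = ∑ g ∈ evenPerms S, f g := by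
  refine sum_nbij' (fun b => a * b) (fun g => a⁻¹ * g) ?_ ?_ ?_ ?_ ?_
  · exact fun b hb => mul_mem_evenPerms ha hb
  · exact fun g hg => mul_mem_evenPerms (inv_mem_evenPerms ha) hg
  all_goals simp

theorem card_filter_evenPerms {S : Finset α} (hS : 3 ≤ #S) {j l : α} (hj : j ∈ S) (hl : l ∈ S) :
    #{g ∈ evenPerms S | g j = l} = #(evenPerms (S.erase j)) := by
  obtain ⟨t, ht, rfl⟩ := exists_mem_evenPerms_apply_eq hS hj hl
  simpa using (sum_evenPerms_erase_mul ht j fun _ => (1 : ℕ)).symm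

theorem card_evenPerms_eq_mul {S : Finset α} (hS : 3 ≤ #S) {j : α} (hj : j ∈ S) :
    #(evenPerms S) = #S * #(evenPerms (S.erase j)) := by
  rw [card_eq_sum_card_fiberwise (f := fun g : Perm α => g j) (t := S)
    (fun g hg => apply_mem_of_mem_evenPerms hg hj), sum_congr rfl
    (fun l hl => card_filter_evenPerms hS hj hl)]
  simp

theorem sum_evenPerms_apply {M : Type*} [AddCommMonoid M] {S : Finset α} (hS : 3 ≤ #S) {j : α}
    (hj : j ∈ S) (F : α → M) :
    #S • ∑ a ∈ evenPerms S, F (a j) = #(evenPerms S) • ∑ l ∈ S, F l := by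
  rw [← sum_fiberwise_of_maps_to (g := fun g : Perm α => g j) (t := S)
    (fun g hg => apply_mem_of_mem_evenPerms hg hj)]
  have : ∀ l ∈ S, ∑ a ∈ evenPerms S with a j = l, F (a j) = #(evenPerms (S.erase j)) • F l := by
    intro l hl
    rw [← card_filter_evenPerms hS hj hl, ← sum_const]
    exact sum_congr rfl fun a ha => by rw [(mem_filter.1 ha).2]
  rw [sum_congr rfl this, ← smul_sum, smul_smul, ← card_evenPerms_eq_mul hS hj]

theorem evenPerms_eq_singleton {S : Finset α} (hS : #S ≤ 2) : evenPerms S = {1} := by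
  ext g
  rw [mem_evenPerms, mem_singleton]
  refine ⟨fun ⟨h1, h2⟩ => ?_, by rintro rfl; simp⟩
  have h3 := (card_le_card h2).trans hS
  rcases h3.lt_or_eq with h | h
  · exact Perm.card_support_le_one.1 (by omega)
  · rw [(Perm.card_support_eq_two.1 h).sign_eq] at h1
    exact absurd h1 (by decide)

theorem one_notMem_threeCyclesOn (S : Finset α) : (1 : Perm α) ∉ threeCyclesOn S := by
  intro h
  simpa using (mem_threeCyclesOn.1 h).1.card_support

theorem evenPerms_of_card_eq_three {S : Finset α} (hS : #S = 3) :
    evenPerms S = insert 1 (threeCyclesOn S) := by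
  ext g
  rw [mem_insert, mem_evenPerms, mem_threeCyclesOn]
  constructor
  · rintro ⟨h1, h2⟩
    have h3 := (card_le_card h2).trans hS.le
    rcases h3.lt_or_eq with h | h
    · rw [← mem_singleton, ← evenPerms_eq_singleton (S := g.support) (by omega), mem_evenPerms]
      simp [h1]
    · exact Or.inr ⟨card_support_eq_three_iff.1 h, h2⟩
  · rintro (rfl | h)
    · simp
    · exact ⟨h.1.sign, h.2⟩

theorem card_evenPerms_of_card_eq_three {S : Finset α} (hS : #S = 3) : #(evenPerms S) = 3 := by
  obtain ⟨j, hj⟩ := card_pos.1 (by omega : 0 < #S)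
  rw [card_evenPerms_eq_mul hS.ge hj, evenPerms_eq_singleton (by rw [card_erase_of_mem hj]; omega),
    hS, card_singleton]

theorem mem_threeCyclesOn_erase {S : Finset α} {i : α} {g : Perm α} :
    g ∈ threeCyclesOn (S.erase i) ↔ g ∈ threeCyclesOn S ∧ g i = i := by
  rw [mem_threeCyclesOn, mem_threeCyclesOn, subset_erase, Perm.notMem_support, and_assoc]

/-- Each 3-cycle supported in `S` fixes `#S - 3` points of `S`. -/
theorem sum_sum_threeCyclesOn_erase (S : Finset α) (F : Perm α → ℝ) :
    ∑ i ∈ S, ∑ c ∈ threeCyclesOn (S.erase i), F c =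
      ((#S : ℝ) - 3) * ∑ c ∈ threeCyclesOn S, F c := by
  have h1 : ∀ i ∈ S, ∑ c ∈ threeCyclesOn (S.erase i), F c =
      ∑ c ∈ threeCyclesOn S, if c i = i then F c else 0 := by
    intro i _
    rw [← sum_filter]
    exact sum_congr (by ext c; rw [mem_threeCyclesOn_erase, mem_filter]) fun _ _ => rfl
  rw [sum_congr rfl h1, sum_comm, mul_sum]
  refine sum_congr rfl fun c hc => ?_
  rw [mem_threeCyclesOn] at hc
  have h2 : {i ∈ S | c i = i} = S \ c.support := by
    ext i; simp
  rw [← sum_filter, sum_const, h2, nsmul_eq_mul, cast_card_sdiff hc.2, hc.1.card_support]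
  norm_num

theorem card_threeCyclesOn {S : Finset α} (hS : 2 ≤ #S) :
    (#(threeCyclesOn S) : ℝ) = #S * (#S - 1) * (#S - 2) / 3 := by
  generalize hk : #S = k at hS ⊢
  induction k, hS using Nat.le_induction generalizing S with
  | base =>
    have : threeCyclesOn S = ∅ := by
      refine eq_empty_of_forall_notMem fun c hc => ?_
      rw [mem_threeCyclesOn] at hc
      have := card_le_card hc.2
      rw [hc.1.card_support] at this
      omega
    simp [this]
  | succ k hk2 ih =>
    rcases hk2.eq_or_lt with rfl | hk3
    · have h := card_evenPerms_of_card_eq_three hk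
      rw [evenPerms_of_card_eq_three hk, card_insert_of_notMem (one_notMem_threeCyclesOn S)] at h
      have h' : #(threeCyclesOn S) = 2 := by omega
      rw [h']; norm_num
    · have h := sum_sum_threeCyclesOn_erase S fun _ => 1
      have h1 : ∀ i ∈ S, ∑ c ∈ threeCyclesOn (S.erase i), (1 : ℝ) = k * (k - 1) * (k - 2) / 3 := by
        intro i hi
        have h2 : #(S.erase i) = k := by rw [card_erase_of_mem hi]; omega
        simpa using ih h2
      rw [sum_congr rfl h1] at h
      simp only [sum_const, nsmul_eq_mul, mul_one, hk] at h
      have hk3' : (2 : ℝ) < k := by exact_mod_cast hk3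
      have h3 : ((k : ℝ) - 2) ≠ 0 := by linarith
      push_cast at h ⊢
      apply mul_left_cancel₀ h3
      linarith

end EvenPerms

section Representation

variable {α : Type*} [Fintype α] [DecidableEq α]
variable {V : Type*} [NormedAddCommGroup V] [InnerProductSpace ℝ V]

/-- The averaging operator over the even permutations supported in `S`. -/
noncomputable def evenAvg (ρ : Representation ℝ (Perm α) V) (S : Finset α) : V →ₗ[ℝ] V :=
  (#(evenPerms S) : ℝ)⁻¹ • ∑ g ∈ evenPerms S, ρ g

theorem evenAvg_apply (ρ : Representation ℝ (Perm α) V) (S : Finset α) (v : V) :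
    evenAvg ρ S v = (#(evenPerms S) : ℝ)⁻¹ • ∑ g ∈ evenPerms S, ρ g v := by
  simp [evenAvg]

theorem inner_evenAvg_left {ρ : Representation ℝ (Perm α) V}
    (hρ : ∀ g v w, inner ℝ (ρ g v) (ρ g w) = inner ℝ v w) (S : Finset α) (v w : V) :
    inner ℝ (evenAvg ρ S v) w = inner ℝ v (evenAvg ρ S w) := by
  simp only [evenAvg_apply, real_inner_smul_left, real_inner_smul_right, sum_inner, inner_sum]
  congr 1
  refine sum_nbij' (fun g => g⁻¹) (fun g => g⁻¹) (fun g hg => inv_mem_evenPerms hg)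
    (fun g hg => inv_mem_evenPerms hg) (by simp) (by simp) fun g _ => ?_
  rw [← hρ g v (ρ g⁻¹ w), ← Module.End.mul_apply, ← map_mul]
  simp

theorem apply_evenAvg (ρ : Representation ℝ (Perm α) V) {S : Finset α} {g : Perm α}
    (hg : g ∈ evenPerms S) (v : V) : ρ g (evenAvg ρ S v) = evenAvg ρ S v := by
  simp only [evenAvg_apply, map_smul, map_sum]
  congr 1
  rw [← sum_evenPerms_mul_left hg fun x => ρ x v]
  simp

theorem evenAvg_evenAvg_of_subset (ρ : Representation ℝ (Perm α) V) {S T : Finset α} (h : T ⊆ S)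
    (v : V) : evenAvg ρ T (evenAvg ρ S v) = evenAvg ρ S v := by
  have hT : (#(evenPerms T) : ℝ) ≠ 0 := by exact_mod_cast (card_evenPerms_pos T).ne'
  rw [evenAvg_apply, sum_congr rfl fun g hg => apply_evenAvg ρ (evenPerms_mono h hg) v, sum_const,
    ← Nat.cast_smul_eq_nsmul ℝ, smul_smul, inv_mul_cancel₀ hT, one_smul]

theorem evenAvg_evenAvg_of_superset {ρ : Representation ℝ (Perm α) V}
    (hρ : ∀ g v w, inner ℝ (ρ g v) (ρ g w) = inner ℝ v w) {S T : Finset α} (h : T ⊆ S) (v : V) :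
    evenAvg ρ S (evenAvg ρ T v) = evenAvg ρ S v := by
  refine ext_inner_right ℝ fun w => ?_
  rw [inner_evenAvg_left hρ, inner_evenAvg_left hρ, evenAvg_evenAvg_of_subset ρ h,
    inner_evenAvg_left hρ]

/-- Averaging over the stabilizer of `j` and then over the stabilizer of `i ≠ j` is averaging
over all `g` with `g j ≠ i`. -/
theorem evenAvg_erase_evenAvg_erase (ρ : Representation ℝ (Perm α) V) {S : Finset α}
    (hS : 4 ≤ #S) {i j : α} (hi : i ∈ S) (hj : j ∈ S) (hij : i ≠ j) (v : V) :
    ((#S : ℝ) - 1) • evenAvg ρ (S.erase i) (evenAvg ρ (S.erase j) v) =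
      (#(evenPerms (S.erase j)) : ℝ)⁻¹ •
        ∑ l ∈ S.erase i, ∑ g ∈ evenPerms S with g j = l, ρ g v := by
  have hi0 : (#(evenPerms (S.erase i)) : ℝ) ≠ 0 := by
    exact_mod_cast (card_evenPerms_pos (S.erase i)).ne'
  have hc : #(S.erase i) = #S - 1 := card_erase_of_mem hi
  have h := sum_evenPerms_apply (S := S.erase i) (by omega) (mem_erase.2 ⟨hij.symm, hj⟩)
    fun l => ∑ g ∈ evenPerms S with g j = l, ρ g v
  rw [← Nat.cast_smul_eq_nsmul ℝ, ← Nat.cast_smul_eq_nsmul ℝ, hc,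
    Nat.cast_sub (by omega), Nat.cast_one] at h
  have h1 : evenAvg ρ (S.erase i) (evenAvg ρ (S.erase j) v) =
      (#(evenPerms (S.erase i)) : ℝ)⁻¹ • (#(evenPerms (S.erase j)) : ℝ)⁻¹ •
        ∑ a ∈ evenPerms (S.erase i), ∑ g ∈ evenPerms S with g j = a j, ρ g v := by
    simp only [evenAvg_apply, map_smul, map_sum, ← smul_sum]
    rw [sum_comm, smul_comm]
    congr 2
    refine sum_congr rfl fun a ha => ?_
    rw [← sum_evenPerms_erase_mul (mem_evenPerms_erase.1 ha).1 j fun g => ρ g v]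
    simp
  rw [h1, smul_comm, smul_comm ((#S : ℝ) - 1), h, smul_comm _ (#(evenPerms (S.erase i)) : ℝ),
    smul_smul, inv_mul_cancel₀ hi0, one_smul]

theorem sum_evenAvg_erase_evenAvg_erase (ρ : Representation ℝ (Perm α) V) {S : Finset α}
    (hS : 4 ≤ #S) {j : α} (hj : j ∈ S) (v : V) :
    ((#S : ℝ) - 1) • ∑ i ∈ S, evenAvg ρ (S.erase i) (evenAvg ρ (S.erase j) v) =
      (#S : ℝ) • evenAvg ρ (S.erase j) v + ((#S : ℝ) * (#S - 2)) • evenAvg ρ S v := by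
  set N : ℝ := (#(evenPerms (S.erase j)) : ℝ) with hN
  have hN0 : N ≠ 0 := by
    rw [hN]; exact_mod_cast (card_evenPerms_pos (S.erase j)).ne'
  have hS0 : (#S : ℝ) ≠ 0 := by norm_cast; omega
  set F : α → V := fun l => ∑ g ∈ evenPerms S with g j = l, ρ g v with hF
  have hsum : ∑ l ∈ S, F l = (#S * N) • evenAvg ρ S v := by
    rw [hF, sum_fiberwise_of_maps_to fun g hg => apply_mem_of_mem_evenPerms hg hj, evenAvg_apply,
      card_evenPerms_eq_mul (by omega) hj, Nat.cast_mul, ← hN, smul_smul,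
      mul_inv_cancel₀ (mul_ne_zero hS0 hN0), one_smul]
  have hFj : F j = N • evenAvg ρ (S.erase j) v := by
    have h : ∑ b ∈ evenPerms (S.erase j), ρ b v = F j := by
      have h := sum_evenPerms_erase_mul (one_mem_evenPerms S) j fun g => ρ g v
      simp only [one_mul] at h
      exact h
    rw [← h, evenAvg_apply, ← hN, smul_smul, mul_inv_cancel₀ hN0, one_smul]
  have hoff : ∀ i ∈ S.erase j,
      ((#S : ℝ) - 1) • evenAvg ρ (S.erase i) (evenAvg ρ (S.erase j) v) =
        (#S : ℝ) • evenAvg ρ S v - N⁻¹ • F i := by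
    intro i hi
    rw [mem_erase] at hi
    rw [evenAvg_erase_evenAvg_erase ρ hS hi.2 hj hi.1, sum_erase_eq_sub hi.2, ← hN]
    change N⁻¹ • (∑ l ∈ S, F l - F i) = _
    rw [hsum, smul_sub, smul_smul]
    congr 2
    field_simp
  rw [smul_sum, ← add_sum_erase _ _ hj, sum_congr rfl hoff,
    evenAvg_evenAvg_of_subset ρ subset_rfl, sum_sub_distrib, ← smul_sum (s := S.erase j) (r := N⁻¹),
    sum_erase_eq_sub (f := F) hj, hsum, hFj, sum_const, card_erase_of_mem hj,
    ← Nat.cast_smul_eq_nsmul ℝ, Nat.cast_sub (by omega), Nat.cast_one]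
  match_scalars <;> field_simp <;> ring

/-- A symmetric map `T` with `T (T v) = κ • T v` and `κ > 0` is bounded above by `κ`. -/
theorem inner_le_mul_of_apply_apply_eq_smul {T : V → V} {κ : ℝ} (hκ : 0 < κ) (v : V)
    (hsymm : inner ℝ (T v) (T v) = inner ℝ (T (T v)) v) (hsq : T (T v) = κ • T v) :
    inner ℝ (T v) v ≤ κ * ‖v‖ ^ 2 := by
  have h := sq_nonneg ‖T v - κ • v‖
  rw [norm_sub_sq_real, ← real_inner_self_eq_norm_sq (T v), hsymm, hsq, norm_smul, mul_pow,
    real_inner_smul_left, real_inner_smul_right, Real.norm_eq_abs, sq_abs] at h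
  have h' : 0 ≤ κ * (κ * ‖v‖ ^ 2 - inner ℝ (T v) v) := by linarith
  linarith [nonneg_of_mul_nonneg_right h' hκ]

theorem sum_inner_evenAvg_erase_le {ρ : Representation ℝ (Perm α) V}
    (hρ : ∀ g v w, inner ℝ (ρ g v) (ρ g w) = inner ℝ v w) {S : Finset α} (hS : 4 ≤ #S) (v : V) :
    ((#S : ℝ) - 1) * ∑ i ∈ S, inner ℝ (evenAvg ρ (S.erase i) v) v ≤
      #S * ‖v‖ ^ 2 + #S * (#S - 2) * inner ℝ (evenAvg ρ S v) v := by
  have hk : (4 : ℝ) ≤ #S := by exact_mod_cast hS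
  have hk1 : (0 : ℝ) < #S - 1 := by linarith
  have hk0 : (0 : ℝ) < #S := by linarith
  set k : ℝ := (#S : ℝ)
  set T : V →ₗ[ℝ] V := (k - 1) • ∑ i ∈ S, evenAvg ρ (S.erase i) - (k * (k - 2)) • evenAvg ρ S
    with hT
  have hTv : ∀ w, T w = (k - 1) • ∑ i ∈ S, evenAvg ρ (S.erase i) w -
      (k * (k - 2)) • evenAvg ρ S w := by
    intro w
    simp [hT]
  have hTS : T (evenAvg ρ S v) = k • evenAvg ρ S v := by
    rw [hTv, sum_congr rfl fun i _ => evenAvg_evenAvg_of_subset ρ (erase_subset i S) v,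
      evenAvg_evenAvg_of_subset ρ subset_rfl, sum_const, ← Nat.cast_smul_eq_nsmul ℝ]
    module
  have hTj : ∀ j ∈ S, T (evenAvg ρ (S.erase j) v) = k • evenAvg ρ (S.erase j) v := by
    intro j hj
    rw [hTv, sum_evenAvg_erase_evenAvg_erase ρ hS hj,
      evenAvg_evenAvg_of_superset hρ (erase_subset j S), add_sub_cancel_right]
  have hsq : T (T v) = k • T v := by
    rw [hTv v, map_sub, map_smul, map_smul, map_sum, sum_congr rfl hTj, hTS, ← smul_sum]
    module
  have hsymm : inner ℝ (T v) (T v) = inner ℝ (T (T v)) v := by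
    generalize hw : T v = w
    nth_rewrite 2 [← hw]
    rw [hTv v, hTv w]
    simp only [inner_sub_left, inner_sub_right, real_inner_smul_left, real_inner_smul_right,
      sum_inner, inner_sum, inner_evenAvg_left hρ]
  have h := inner_le_mul_of_apply_apply_eq_smul hk0 v hsymm hsq
  rw [hTv, inner_sub_left, real_inner_smul_left, real_inner_smul_left, sum_inner] at h
  linarith

/-- The Poincaré inequality for the 3-cycles supported in `S`. -/
theorem le_sum_threeCyclesOn {ρ : Representation ℝ (Perm α) V}
    (hρ : ∀ g v w, inner ℝ (ρ g v) (ρ g w) = inner ℝ v w) {S : Finset α} (hS : 3 ≤ #S) (v : V) :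
    (#S : ℝ) * (#S - 2) * (‖v‖ ^ 2 - inner ℝ (evenAvg ρ S v) v) ≤
      ∑ c ∈ threeCyclesOn S, (‖v‖ ^ 2 - inner ℝ (ρ c v) v) := by
  generalize hk : #S = k at hS ⊢
  induction k, hS using Nat.le_induction generalizing S with
  | base =>
    have h1 : #(evenPerms S) = 3 := card_evenPerms_of_card_eq_three hk
    have h2 : #(threeCyclesOn S) = 2 := by
      rw [evenPerms_of_card_eq_three hk, card_insert_of_notMem (one_notMem_threeCyclesOn S)] at h1
      omega
    rw [evenAvg_apply, h1, evenPerms_of_card_eq_three hk, sum_insert (one_notMem_threeCyclesOn S),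
      sum_sub_distrib, sum_const, h2, real_inner_smul_left, inner_add_left, sum_inner]
    simp only [map_one, Module.End.one_apply, real_inner_self_eq_norm_sq]
    push_cast
    apply le_of_eq
    ring
  | succ k hk3 ih =>
    have hk3' : (3 : ℝ) ≤ k := by exact_mod_cast hk3
    have h := sum_sum_threeCyclesOn_erase S fun c => ‖v‖ ^ 2 - inner ℝ (ρ c v) v
    have h1 := sum_le_sum fun i (hi : i ∈ S) =>
      ih (S := S.erase i) (by rw [card_erase_of_mem hi]; omega)
    rw [h, ← mul_sum, sum_sub_distrib, sum_const, nsmul_eq_mul, hk] at h1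
    have h2 := sum_inner_evenAvg_erase_le hρ (S := S) (by omega) v
    rw [hk] at h2
    push_cast at h1 h2 ⊢
    have h3 : (0 : ℝ) < k - 2 := by linarith
    refine le_of_mul_le_mul_left ?_ h3
    have h4 := mul_le_mul_of_nonneg_left h2 h3.le
    linarith

end Representation

section RegularRepresentation

variable {G : Type*} [Group G] [Fintype G]

/-- The left regular representation on `ℓ²(G)`. -/
noncomputable def leftRegularL2 (G : Type*) [Group G] [Fintype G] :
    Representation ℝ G (EuclideanSpace ℝ G) where
  toFun g :=
    { toFun := fun f => WithLp.toLp 2 fun x => f (g⁻¹ * x)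
      map_add' := fun _ _ => rfl
      map_smul' := fun _ _ => rfl }
  map_one' := by ext f x; simp
  map_mul' g h := by
    ext f x
    change f ((g * h)⁻¹ * x) = f (h⁻¹ * (g⁻¹ * x))
    rw [mul_inv_rev, mul_assoc]

theorem leftRegularL2_apply (g : G) (f : EuclideanSpace ℝ G) (x : G) :
    leftRegularL2 G g f x = f (g⁻¹ * x) := rfl

theorem inner_leftRegularL2 (g : G) (v w : EuclideanSpace ℝ G) :
    inner ℝ (leftRegularL2 G g v) (leftRegularL2 G g w) = inner ℝ v w := by
  simp only [PiLp.inner_apply, leftRegularL2_apply]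
  exact Equiv.sum_comp (Equiv.mulLeft g⁻¹) fun x => inner ℝ (v x) (w x)

end RegularRepresentation

theorem mem_threeCycles {n : ℕ} {c : Perm (Fin n)} : c ∈ threeCycles n ↔ c.IsThreeCycle := by
  simp [threeCycles]

theorem threeCyclesOn_univ (n : ℕ) : threeCyclesOn (univ : Finset (Fin n)) = threeCycles n := by
  ext; simp [mem_threeCyclesOn, mem_threeCycles]

theorem evenPerms_univ (n : ℕ) :
    evenPerms (univ : Finset (Fin n)) = univ.filter (· ∈ alternatingGroup (Fin n)) := by
  ext; simp [mem_evenPerms, Perm.mem_alternatingGroup]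

theorem card_threeCycles {n : ℕ} (hn : 2 ≤ n) :
    (#(threeCycles n) : ℝ) = n * (n - 1) * (n - 2) / 3 := by
  rw [← threeCyclesOn_univ, card_threeCyclesOn (by simpa using hn)]
  simp

theorem card_threeCycles_pos {n : ℕ} (hn : 3 ≤ n) : (0 : ℝ) < #(threeCycles n) := by
  have hn' : (3 : ℝ) ≤ n := by exact_mod_cast hn
  rw [card_threeCycles (by omega)]
  have h1 : (0 : ℝ) < n - 1 := by linarith
  have h2 : (0 : ℝ) < n - 2 := by linarith
  positivity

theorem inner_cycleConv_le {n : ℕ} (hn : 3 ≤ n) (f : Perm (Fin n) → ℝ)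
    (hf : ∑ x ∈ evenPerms univ, f x = 0) :
    ∑ x ∈ evenPerms univ, cycleConv n f x * f x ≤
      (1 - 3 / ((n : ℝ) - 1)) * ∑ x ∈ evenPerms univ, f x ^ 2 := by
  have hn' : (3 : ℝ) ≤ n := by exact_mod_cast hn
  have hK : (#(threeCycles n) : ℝ) ≠ 0 := (card_threeCycles_pos hn).ne'
  set F : EuclideanSpace ℝ (Perm (Fin n)) :=
    WithLp.toLp 2 fun x => if x ∈ evenPerms univ then f x else 0 with hF
  have hFx : ∀ x, F x = if x ∈ evenPerms univ then f x else 0 := fun _ => rfl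
  have hinner : ∀ g ∈ evenPerms univ, inner ℝ (leftRegularL2 _ g F) F =
      ∑ x ∈ evenPerms univ, f (g⁻¹ * x) * f x := by
    intro g hg
    have h : ∀ x ∈ evenPerms univ, g⁻¹ * x ∈ evenPerms univ :=
      fun x hx => mul_mem_evenPerms (inv_mem_evenPerms hg) hx
    simp only [PiLp.inner_apply, leftRegularL2_apply, hFx, RCLike.inner_apply, conj_trivial]
    rw [← sum_subset (subset_univ (evenPerms univ)) fun x _ hx => by simp [hx]]
    refine sum_congr rfl fun x hx => ?_
    rw [if_pos hx, if_pos (h x hx), mul_comm]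
  have hnorm : ‖F‖ ^ 2 = ∑ x ∈ evenPerms univ, f x ^ 2 := by
    rw [← real_inner_self_eq_norm_sq]
    simpa [sq] using hinner 1 (one_mem_evenPerms _)
  have havg : inner ℝ (evenAvg (leftRegularL2 _) univ F) F = 0 := by
    rw [evenAvg_apply, real_inner_smul_left, sum_inner, sum_congr rfl hinner, sum_comm]
    have h : ∀ x ∈ evenPerms (univ : Finset (Fin n)),
        ∑ g ∈ evenPerms univ, f (g⁻¹ * x) * f x = 0 := by
      intro x hx
      rw [← sum_mul, ← zero_mul (f x), ← hf]
      congr 1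
      refine sum_nbij' (fun g => g⁻¹ * x) (fun y => x * y⁻¹)
        (fun g hg => mul_mem_evenPerms (inv_mem_evenPerms hg) hx)
        (fun y hy => mul_mem_evenPerms hx (inv_mem_evenPerms hy)) ?_ ?_ ?_ <;> simp
    rw [sum_congr rfl h]
    simp
  have hcyc : ∑ c ∈ threeCyclesOn univ, inner ℝ (leftRegularL2 _ c F) F =
      #(threeCycles n) * ∑ x ∈ evenPerms univ, cycleConv n f x * f x := by
    have h : ∀ c ∈ threeCyclesOn (univ : Finset (Fin n)), c ∈ evenPerms univ := fun c hc =>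
      mem_evenPerms.2 ⟨(mem_threeCyclesOn.1 hc).1.sign, subset_univ _⟩
    rw [sum_congr rfl fun c hc => hinner c (h c hc), sum_comm, mul_sum, threeCyclesOn_univ]
    refine sum_congr rfl fun x _ => ?_
    rw [← sum_mul, cycleConv]
    field_simp
  have h := le_sum_threeCyclesOn inner_leftRegularL2 (S := univ) (by simpa using hn) F
  rw [sum_sub_distrib, hcyc, havg, sum_const, threeCyclesOn_univ, nsmul_eq_mul, hnorm,
    card_threeCycles (by omega), card_univ, Fintype.card_fin] at h
  have h1 : (0 : ℝ) < n - 1 := by linarith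
  have h2 : (0 : ℝ) < n * (n - 2) := mul_pos (by linarith) (by linarith)
  generalize ∑ x ∈ evenPerms univ, cycleConv n f x * f x = Y at h ⊢
  generalize ∑ x ∈ evenPerms univ, f x ^ 2 = X at h ⊢
  have h3 : ((n : ℝ) - 1) * Y ≤ (n - 4) * X := by
    refine le_of_mul_le_mul_left ?_ h2
    linarith
  have h4 : (1 - 3 / ((n : ℝ) - 1)) * X = (n - 4) * X / (n - 1) := by
    field_simp
    ring
  rw [h4, le_div_iff₀ h1]
  linarith

theorem card_filter_threeCycles_congr {n : ℕ} {i j k : Fin n} (hj : j ≠ i) (hk : k ≠ i) :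
    #{c ∈ threeCycles n | c⁻¹ i = j} = #{c ∈ threeCycles n | c⁻¹ i = k} := by
  have hi : swap j k i = i := swap_apply_of_ne_of_ne hj.symm hk.symm
  have hconj : ∀ c ∈ threeCycles n, swap j k * c * swap j k ∈ threeCycles n := by
    intro c hc
    rw [mem_threeCycles, Perm.IsThreeCycle] at hc ⊢
    rw [← hc, ← Perm.cycleType_conj (σ := c) (τ := swap j k), swap_inv]
  refine card_nbij' (fun c => swap j k * c * swap j k) (fun c => swap j k * c * swap j k)
    ?_ ?_ ?_ ?_
  · intro c hc
    rw [mem_coe, mem_filter] at hc ⊢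
    exact ⟨hconj c hc.1, by
      rw [mul_inv_rev, mul_inv_rev, swap_inv, Perm.mul_apply, Perm.mul_apply, hi, hc.2]
      simp⟩
  · intro c hc
    rw [mem_coe, mem_filter] at hc ⊢
    exact ⟨hconj c hc.1, by
      rw [mul_inv_rev, mul_inv_rev, swap_inv, Perm.mul_apply, Perm.mul_apply, hi, hc.2]
      simp⟩
  all_goals
    intro c _
    simp [mul_assoc]

theorem card_filter_threeCycles_self {n : ℕ} (hn : 3 ≤ n) (i : Fin n) :
    (#{c ∈ threeCycles n | c⁻¹ i = i} : ℝ) = (n - 1) * (n - 2) * (n - 3) / 3 := by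
  have h : {c ∈ threeCycles n | c⁻¹ i = i} = threeCyclesOn (univ.erase i) := by
    ext c
    rw [mem_threeCyclesOn_erase, threeCyclesOn_univ, mem_filter, Perm.inv_eq_iff_eq,
      eq_comm (a := i)]
  have hc : #(univ.erase i) = n - 1 := by simp
  rw [h, card_threeCyclesOn (by omega), hc, Nat.cast_sub (by omega)]
  push_cast
  ring

theorem card_filter_threeCycles {n : ℕ} (hn : 3 ≤ n) {i j : Fin n} (hij : j ≠ i) :
    (#{c ∈ threeCycles n | c⁻¹ i = j} : ℝ) = n - 2 := by
  have hn' : (3 : ℝ) ≤ n := by exact_mod_cast hn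
  have h := card_eq_sum_card_fiberwise (s := threeCycles n) (f := fun c => c⁻¹ i) (t := univ)
    fun _ _ => mem_coe.2 (mem_univ _)
  rw [← add_sum_erase _ _ (mem_univ i),
    sum_congr rfl fun k hk => card_filter_threeCycles_congr (mem_erase.1 hk).1 hij] at h
  have h' := congrArg (Nat.cast (R := ℝ)) h
  rw [sum_const, card_erase_of_mem (mem_univ i), card_univ, Fintype.card_fin, Nat.cast_add,
    card_filter_threeCycles_self hn, card_threeCycles (by omega), smul_eq_mul, Nat.cast_mul,
    Nat.cast_sub (by omega)] at h'
  push_cast at h'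
  have h1 : (n : ℝ) - 1 ≠ 0 := by linarith
  apply mul_left_cancel₀ h1
  linarith

/-- Averaging a mean-zero function of a point over the 3-cycles multiplies it by
`1 - 3 / (n - 1)`. -/
theorem average_threeCycles_apply {n : ℕ} (hn : 3 ≤ n) {u : Fin n → ℝ} (hu : ∑ i, u i = 0)
    (i : Fin n) :
    1 / (#(threeCycles n) : ℝ) * ∑ c ∈ threeCycles n, u (c⁻¹ i) =
      (1 - 3 / ((n : ℝ) - 1)) * u i := by
  have hn' : (3 : ℝ) ≤ n := by exact_mod_cast hn
  have hfib : ∀ j, ∑ c ∈ threeCycles n with c⁻¹ i = j, u (c⁻¹ i) =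
      #{c ∈ threeCycles n | c⁻¹ i = j} * u j := by
    intro j
    rw [sum_congr rfl fun c hc => by rw [(mem_filter.1 hc).2], sum_const, nsmul_eq_mul]
  have hsum : ∑ c ∈ threeCycles n, u (c⁻¹ i) = n * (n - 2) * (n - 4) / 3 * u i := by
    rw [← sum_fiberwise (threeCycles n) (fun c => c⁻¹ i), sum_congr rfl fun j _ => hfib j,
      ← add_sum_erase _ _ (mem_univ i), card_filter_threeCycles_self hn,
      sum_congr rfl fun j hj => by rw [card_filter_threeCycles hn (mem_erase.1 hj).1], ← mul_sum,
      sum_erase_eq_sub (mem_univ i), hu]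
    ring
  have h1 : (n : ℝ) - 1 ≠ 0 := by linarith
  have h2 : (n : ℝ) - 2 ≠ 0 := by linarith
  have h0 : (n : ℝ) ≠ 0 := by linarith
  rw [hsum, card_threeCycles (by omega)]
  field_simp
  ring

/-- **The spectral gap of `Alt(n)` with respect to 3-cycles is exactly `3/(n−1)`:**
(i) for every mean-zero `f : Alt(n) → ℝ`, `⟨Mf, f⟩ ≤ (1 − 3/(n−1))·‖f‖²`, and
(ii) there is a nonzero mean-zero eigenfunction of `M` with eigenvalue `1 − 3/(n−1)`. -/
theorem spectral_gap_alternating_three_cycles (n : ℕ) (hn : 3 ≤ n) :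
    (∀ f : Perm (Fin n) → ℝ,
        (∑ x ∈ Finset.univ.filter (· ∈ alternatingGroup (Fin n)), f x) = 0 →
          ∑ x ∈ Finset.univ.filter (· ∈ alternatingGroup (Fin n)),
              cycleConv n f x * f x ≤
            (1 - 3 / ((n : ℝ) - 1)) *
              ∑ x ∈ Finset.univ.filter (· ∈ alternatingGroup (Fin n)), f x ^ 2) ∧
      (∃ f : Perm (Fin n) → ℝ,
        (∃ x ∈ Finset.univ.filter (· ∈ alternatingGroup (Fin n)), f x ≠ 0) ∧
        (∑ x ∈ Finset.univ.filter (· ∈ alternatingGroup (Fin n)), f x) = 0 ∧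
        ∀ x ∈ Finset.univ.filter (· ∈ alternatingGroup (Fin n)),
          cycleConv n f x = (1 - 3 / ((n : ℝ) - 1)) * f x) := by
  rw [← evenPerms_univ]
  refine ⟨inner_cycleConv_le hn, ?_⟩
  let i₀ : Fin n := ⟨0, by omega⟩
  let i₁ : Fin n := ⟨1, by omega⟩
  have hne : i₀ ≠ i₁ := by simp [i₀, i₁]
  let u : Fin n → ℝ := fun i => (if i = i₀ then 1 else 0) - if i = i₁ then 1 else 0
  have hu : ∑ i, u i = 0 := by simp [u]
  refine ⟨fun x => u (x i₀), ⟨1, one_mem_evenPerms _, by simp [u, hne]⟩, ?_, fun x _ => ?_⟩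
  · have h := sum_evenPerms_apply (S := univ) (by simpa using hn) (mem_univ i₀) u
    rw [hu, smul_zero, smul_eq_zero, card_univ, Fintype.card_fin] at h
    exact h.resolve_left (by omega)
  · exact average_threeCycles_apply hn hu (x i₀)
end

section
/- Let n ≥ 3. For every partition λ of n with λ ≠ (n) and λ ≠ (1,1,…,1), one has M₃(λ) ≤ M₃((n−1,1)) = (n−2)(n−1)(2n−3) + 6. (This expresses that among the eigenvalues M₃(λ)/(2n(n−1)(n−2)) − 3/(2(n−2)) of the 3-cycle convolution operator, the largest eigenvalue 1 corresponds to the partitions (n) and (1,…,1), and the second largest corresponds to (n−1,1) and its conjugate (2,1,…,1).) -/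
/-- A partition of `n`, encoded (0-based) as a nonincreasing function `ℕ → ℕ` extended by
zero parts; a partition of `n` has at most `n` nonzero parts, so all parts of index `≥ n`
vanish and the parts sum to `n`. The part written `λ_j` (1-based) is `lam (j-1)`. -/
def IsPartitionFun (n : ℕ) (lam : ℕ → ℕ) : Prop :=
  Antitone lam ∧ (∀ j, n ≤ j → lam j = 0) ∧ (∑ j ∈ Finset.range n, lam j) = n

/-- `M₃(λ) = ∑_j ((λ_j − j)(λ_j − j + 1)(2λ_j − 2j + 1) + j(j − 1)(2j − 1))` (sum over all
1-based indices `j`; indices with `λ_j = 0` contribute `0`). -/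
def M3 (n : ℕ) (lam : ℕ → ℕ) : ℤ :=
  ∑ j ∈ Finset.range n,
    (((lam j : ℤ) - ((j : ℤ) + 1)) * ((lam j : ℤ) - ((j : ℤ) + 1) + 1) *
        (2 * (lam j : ℤ) - 2 * ((j : ℤ) + 1) + 1) +
      ((j : ℤ) + 1) * (j : ℤ) * (2 * ((j : ℤ) + 1) - 1))

/-- Appending a row of length `l` at height `j` adds at most as much as prolonging a first row
of length `N ≥ j` by `l` cells: each cell contributes six times the square of its content. -/
lemma row_contribution_le (j N : ℤ) (hj : 0 ≤ j) (hN : j ≤ N) (l : ℕ) :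
    ((l : ℤ) - (j + 1)) * ((l : ℤ) - (j + 1) + 1) * (2 * (l : ℤ) - 2 * (j + 1) + 1) +
        (j + 1) * j * (2 * (j + 1) - 1) ≤
      (N + l) * (N + l - 1) * (2 * (N + l) - 1) - N * (N - 1) * (2 * N - 1) := by
  induction l with
  | zero => apply le_of_eq; push_cast; ring
  | succ l ih =>
    have hsq : ((l : ℤ) - j) ^ 2 ≤ (N + l) ^ 2 := by
      apply sq_le_sq'
      · linarith [Int.natCast_nonneg l]
      · linarith
    push_cast
    linarith

lemma succ_le_sum_range_of_antitone {lam : ℕ → ℕ} (hanti : Antitone lam) (h0 : 2 ≤ lam 0)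
    (J : ℕ) (hJ : 1 ≤ J) (hpos : 1 ≤ lam J) : J + 1 ≤ ∑ j ∈ Finset.range J, lam j := by
  induction J, hJ using Nat.le_induction with
  | base => simpa using h0
  | succ J hJ ih =>
    have hle : 1 ≤ lam J := hpos.trans (hanti J.le_succ)
    rw [Finset.sum_range_succ]
    linarith [ih hle]

lemma M3_le_of_antitone {lam : ℕ → ℕ} (hanti : Antitone lam) (h0 : 2 ≤ lam 0) (h1 : 1 ≤ lam 1)
    (J : ℕ) (hJ : 2 ≤ J) :
    M3 J lam ≤ ((∑ j ∈ Finset.range J, (lam j : ℤ)) - 1) *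
        ((∑ j ∈ Finset.range J, (lam j : ℤ)) - 2) *
        (2 * (∑ j ∈ Finset.range J, (lam j : ℤ)) - 3) + 6 := by
  induction J, hJ using Nat.le_induction with
  | base =>
    obtain ⟨b, hb⟩ := Nat.exists_eq_add_of_le' h1
    have hrow := row_contribution_le 0 (lam 0) le_rfl (by positivity) b
    simp only [M3, Finset.sum_range_succ, Finset.sum_range_zero, hb]
    push_cast
    linarith
  | succ J hJ ih =>
    rw [M3, Finset.sum_range_succ, Finset.sum_range_succ, ← M3]
    rcases Nat.eq_zero_or_pos (lam J) with hz | hpos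
    · rw [hz]
      push_cast
      linarith
    · have hN : ((J + 1 : ℕ) : ℤ) ≤ ((∑ j ∈ Finset.range J, lam j : ℕ) : ℤ) :=
        Int.ofNat_le.2 (succ_le_sum_range_of_antitone hanti h0 J (by lia) hpos)
      push_cast at hN
      have hrow := row_contribution_le J ((∑ j ∈ Finset.range J, (lam j : ℤ)) - 1)
        (by positivity) (by linarith) (lam J)
      linarith

lemma M3_row_append_one (n : ℕ) (hn : 2 ≤ n) :
    M3 n (fun j => if j = 0 then n - 1 else if j = 1 then 1 else 0) =
      ((n : ℤ) - 2) * ((n : ℤ) - 1) * (2 * (n : ℤ) - 3) + 6 := by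
  obtain ⟨m, rfl⟩ := Nat.exists_eq_add_of_le' hn
  rw [M3, Finset.sum_range_succ', Finset.sum_range_succ', Finset.sum_eq_zero]
  · have hm : m + 2 - 1 = m + 1 := by lia
    simp only [hm, if_true, zero_add, one_ne_zero, if_false]
    push_cast
    ring
  · intro j _
    have hj : ¬ (j + 1 + 1 = 0) ∧ ¬ (j + 1 + 1 = 1) := by lia
    simp only [hj.1, hj.2, if_false]
    push_cast
    ring

namespace IsPartitionFun

variable {n : ℕ} {lam : ℕ → ℕ}

lemma one_le_apply_one (h : IsPartitionFun n lam) (hn : 1 ≤ n)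
    (hrow : lam ≠ fun j => if j = 0 then n else 0) : 1 ≤ lam 1 := by
  obtain ⟨hanti, -, hsum⟩ := h
  by_contra! hlt
  have hz : ∀ j, j ≠ 0 → lam j = 0 := fun j hj => by
    have := hanti (Nat.one_le_iff_ne_zero.2 hj)
    lia
  apply hrow
  funext j
  split_ifs with hj
  · rw [hj, ← hsum, Finset.sum_eq_single 0 (fun i _ hi => hz i hi)]
    intro hmem
    exact absurd (Finset.mem_range.2 hn) hmem
  · exact hz j hj

lemma two_le_apply_zero (h : IsPartitionFun n lam)
    (hcol : lam ≠ fun j => if j < n then 1 else 0) : 2 ≤ lam 0 := by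
  obtain ⟨hanti, hzero, hsum⟩ := h
  by_contra! hlt
  have hle : ∀ j ∈ Finset.range n, lam j ≤ 1 := fun j _ => by
    have := hanti (Nat.zero_le j)
    lia
  apply hcol
  funext j
  split_ifs with hj
  · exact (Finset.sum_eq_sum_iff_of_le hle).1 (by simpa using hsum) j (Finset.mem_range.2 hj)
  · exact hzero j (by lia)

end IsPartitionFun

/-- **Second largest value of `M₃`.** For `n ≥ 3` and every partition `λ` of `n` other
than `(n)` and `(1,1,…,1)`, one has `M₃(λ) ≤ M₃((n−1,1)) = (n−2)(n−1)(2n−3) + 6`. -/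
theorem M3_second_largest (n : ℕ) (hn : 3 ≤ n) (lam : ℕ → ℕ) (h : IsPartitionFun n lam)
    (h1 : lam ≠ fun j => if j = 0 then n else 0)
    (h2 : lam ≠ fun j => if j < n then 1 else 0) :
    M3 n lam ≤ ((n : ℤ) - 2) * ((n : ℤ) - 1) * (2 * (n : ℤ) - 3) + 6 ∧
      M3 n (fun j => if j = 0 then n - 1 else if j = 1 then 1 else 0) =
        ((n : ℤ) - 2) * ((n : ℤ) - 1) * (2 * (n : ℤ) - 3) + 6 := by
  refine ⟨?_, M3_row_append_one n (by lia)⟩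
  have hle := M3_le_of_antitone h.1 (h.two_le_apply_zero h2)
    (h.one_le_apply_one (by lia) h1) n (by lia)
  have hsum : ∑ j ∈ Finset.range n, (lam j : ℤ) = n := by exact_mod_cast h.2.2
  rw [hsum] at hle
  linarith
end

section
/- Let λ and λ' be partitions of n with λ ≥ λ' in the dominance order, i.e., Σ_{j≤i} λ_j ≥ Σ_{j≤i} λ'_j for every i (with partitions extended by zero parts). Then there is a finite sequence of partitions λ = μ⁰, μ¹, …, μ^m = λ' of n such that for each i, μ^{i+1} is obtained from μ^i by a single switch: for some indices a < b, μ^{i+1}_a = μ^i_a − 1, μ^{i+1}_b = μ^i_b + 1, and μ^{i+1}_j = μ^i_j for all other j. -/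
open Finset

/-- Move one unit of `f` from index `a` to index `b`. -/
def switchFun (f : ℕ → ℕ) (a b j : ℕ) : ℕ :=
  if j = a then f a - 1 else if j = b then f b + 1 else f j

lemma sum_range_switchFun (f : ℕ → ℕ) {a b : ℕ} (hab : a < b) (ha : 0 < f a) (i : ℕ) :
    ∑ j ∈ range i, switchFun f a b j + (if a < i then 1 else 0) =
      ∑ j ∈ range i, f j + (if b < i then 1 else 0) := by
  induction i with
  | zero => simp
  | succ i ih =>
    rw [sum_range_succ, sum_range_succ, switchFun]
    grind

lemma antitone_switchFun {f : ℕ → ℕ} (hf : Antitone f) {a b : ℕ} (hab : a < b)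
    (ha : ∀ j, a < j → j < b → f j < f a) (hb : ∀ j, a < j → j < b → f b < f j)
    (hfab : f b + 2 ≤ f a) : Antitone (switchFun f a b) := by
  refine antitone_nat_of_succ_le fun j => ?_
  have hj := hf (Nat.le_succ j)
  have haj := ha (j + 1)
  have hbj := hb j
  unfold switchFun
  grind

/-- Below the first index `b` where `g` exceeds `f`, some last index `a` has `g a < f a`. -/
lemma exists_switch_indices {n : ℕ} {f g : ℕ → ℕ} (hf : IsPartitionFun n f)
    (hg : IsPartitionFun n g) (hdom : ∀ i, ∑ j ∈ range i, g j ≤ ∑ j ∈ range i, f j)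
    (hne : f ≠ g) :
    ∃ a b, a < b ∧ g a < f a ∧ f b < g b ∧ (∀ j < b, g j ≤ f j) ∧
      ∀ j, a < j → j < b → f j = g j := by
  have hex : ∃ b, f b < g b := by
    by_contra! hle
    refine hne (funext fun j => ?_)
    by_cases hj : j < n
    · exact ((sum_eq_sum_iff_of_le fun i _ => hle i).1 (hg.2.2.trans hf.2.2.symm) j
        (mem_range.2 hj)).symm
    · rw [hf.2.1 j (not_lt.1 hj), hg.2.1 j (not_lt.1 hj)]
  classical
  set b := Nat.find hex
  have hfb : f b < g b := Nat.find_spec hex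
  have hle : ∀ j < b, g j ≤ f j := fun j hj => not_lt.1 (Nat.find_min hex hj)
  have hne' : ((range b).filter fun j => g j < f j).Nonempty := by
    by_contra hempty
    have hsum : ∑ j ∈ range b, f j ≤ ∑ j ∈ range b, g j := by
      refine sum_le_sum fun j hj => ?_
      by_contra! hlt
      exact hempty ⟨j, mem_filter.2 ⟨hj, hlt⟩⟩
    have := hdom (b + 1)
    rw [sum_range_succ, sum_range_succ] at this
    omega
  obtain ⟨a, ha, hmax⟩ := exists_max_image _ id hne'
  rw [mem_filter, mem_range] at ha
  refine ⟨a, b, ha.1, ha.2, hfb, hle, fun j haj hjb => ?_⟩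
  by_contra hj
  have := hmax j (mem_filter.2 ⟨mem_range.2 hjb, lt_of_le_of_ne (hle j hjb) (Ne.symm hj)⟩)
  exact absurd haj (not_lt.2 this)

lemma exists_switch_toward {n : ℕ} {f g : ℕ → ℕ} (hf : IsPartitionFun n f)
    (hg : IsPartitionFun n g) (hdom : ∀ i, ∑ j ∈ range i, g j ≤ ∑ j ∈ range i, f j)
    (hne : f ≠ g) :
    ∃ a b, a < b ∧ 0 < f a ∧ IsPartitionFun n (switchFun f a b) ∧
      (∀ i, ∑ j ∈ range i, g j ≤ ∑ j ∈ range i, switchFun f a b j) ∧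
      ∑ j ∈ range n, (switchFun f a b j - g j) < ∑ j ∈ range n, (f j - g j) := by
  obtain ⟨a, b, hab, hga, hfb, hle, heq⟩ := exists_switch_indices hf hg hdom hne
  have hbn : b < n := by
    by_contra! hnb
    have := hg.2.1 b hnb
    omega
  have hpos : 0 < f a := by omega
  have hsum := sum_range_switchFun f hab hpos
  refine ⟨a, b, hab, hpos, ⟨antitone_switchFun hf.1 hab ?_ ?_ ?_, ?_, ?_⟩, ?_, ?_⟩
  · intro j haj hjb
    rw [heq j haj hjb]
    exact (hg.1 haj.le).trans_lt hga
  · intro j haj hjb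
    rw [heq j haj hjb]
    exact hfb.trans_le (hg.1 hjb.le)
  · have := hg.1 hab.le
    omega
  · intro j hj
    have := hf.2.1 j hj
    unfold switchFun
    grind
  · have := hsum n
    rw [if_pos (hab.trans hbn), if_pos hbn, hf.2.2] at this
    omega
  · intro i
    have hi := hsum i
    have hdi := hdom i
    by_cases hai : a < i
    · by_cases hbi : b < i
      · simp only [hai, hbi, if_true] at hi
        omega
      · have hlt : ∑ j ∈ range i, g j < ∑ j ∈ range i, f j :=
          sum_lt_sum (fun j hj => hle j (by rw [mem_range] at hj; omega))
            ⟨a, mem_range.2 hai, hga⟩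
        simp only [hai, hbi, if_true, if_false] at hi
        omega
    · have hbi : ¬ b < i := by omega
      simp only [hai, hbi, if_false] at hi
      omega
  · refine sum_lt_sum (fun j _ => ?_) ⟨a, mem_range.2 (hab.trans hbn), ?_⟩
    · unfold switchFun
      grind
    · simp only [switchFun, if_true]
      omega

/-- **Dominance order is generated by single switches.** If `λ ≥ λ'` in the dominance
order (`∑_{j≤i} λ'_j ≤ ∑_{j≤i} λ_j` for every `i`), then there is a finite chain of
partitions `λ = μ⁰, μ¹, …, μ^m = λ'` of `n` in which each `μ^{i+1}` is obtained from
`μ^i` by a single switch: for some indices `a < b`, `μ^{i+1}_a = μ^i_a − 1`,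
`μ^{i+1}_b = μ^i_b + 1`, and all other parts agree. -/
theorem dominance_chain_of_switches (n : ℕ) (lam lam' : ℕ → ℕ)
    (h : IsPartitionFun n lam) (h' : IsPartitionFun n lam')
    (hdom : ∀ i : ℕ, ∑ j ∈ Finset.range i, lam' j ≤ ∑ j ∈ Finset.range i, lam j) :
    ∃ (m : ℕ) (μ : ℕ → ℕ → ℕ),
      μ 0 = lam ∧ μ m = lam' ∧
      (∀ i, i ≤ m → IsPartitionFun n (μ i)) ∧
      (∀ i, i < m → ∃ a b : ℕ, a < b ∧
        μ i a = μ (i + 1) a + 1 ∧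
        μ (i + 1) b = μ i b + 1 ∧
        ∀ j, j ≠ a → j ≠ b → μ (i + 1) j = μ i j) := by
  induction hk : ∑ j ∈ Finset.range n, (lam j - lam' j) using Nat.strong_induction_on
    generalizing lam with
  | _ k ih =>
    by_cases hne : lam = lam'
    · exact ⟨0, fun _ => lam, rfl, hne, fun _ _ => h, fun i hi => absurd hi (Nat.not_lt_zero i)⟩
    obtain ⟨a, b, hab, hpos, hpart, hdom', hlt⟩ := exists_switch_toward h h' hdom hne
    obtain ⟨m, μ, h0, hm, hμ, hstep⟩ := ih _ (hk ▸ hlt) _ hpart hdom' rfl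
    refine ⟨m + 1, fun i => Nat.casesOn i lam μ, rfl, hm, ?_, ?_⟩
    · rintro (_ | i) hi
      · exact h
      · exact hμ i (by omega)
    · rintro (_ | i) hi
      · refine ⟨a, b, hab, ?_⟩
        change lam a = μ 0 a + 1 ∧ μ 0 b = lam b + 1 ∧ ∀ j, j ≠ a → j ≠ b → μ 0 j = lam j
        rw [h0]
        refine ⟨?_, ?_, fun j hja hjb => ?_⟩
        · simp only [switchFun, if_true]
          omega
        · simp [switchFun, hab.ne']
        · simp [switchFun, hja, hjb]
      · exact hstep i (by omega)
end

section
/- Let Ω be a finite set and let s, σ be permutations of Ω; set τ = σ⁻¹sσ and let T = supp(s) be the set of points moved by s. Then, writing A^g for the image of a set A under a permutation g (with the right-action convention x^{gh} = (x^g)^h), the commutator [s,τ] = s⁻¹τ⁻¹sτ satisfies supp([s,τ]) ⊆ (T ∩ T^σ) ∪ (T ∩ T^σ)^s ∪ (T ∩ T^σ)^τ, and consequently |supp([s,τ])| ≤ 3·|T ∩ T^σ|. -/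
open Equiv

/-- A point moved by a commutator of `s` and `t` lies in `supp s ∩ supp t` or in the image of this
set under `s` or `t`. -/
theorem Equiv.Perm.support_commutator_subset {α : Type*} [Fintype α] [DecidableEq α]
    (s t : Perm α) :
    (t * s * t⁻¹ * s⁻¹).support ⊆
      (s.support ∩ t.support) ∪ (s.support ∩ t.support).image ⇑s ∪
        (s.support ∩ t.support).image ⇑t := by
  intro x hx
  contrapose! hx
  simp only [Finset.mem_union, Finset.mem_image, Finset.mem_inter, not_or, not_exists, not_and,
    Perm.mem_support, and_imp] at hx
  obtain ⟨⟨hx, hs⟩, ht⟩ := hx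
  have apply_inv : ∀ (g : Perm α) (y : α), g (g⁻¹ y) = y := Equiv.apply_symm_apply
  have fix_inv : ∀ (g : Perm α) (y : α), g y = y → g⁻¹ y = y := fun g y h ↦
    Perm.inv_eq_iff_eq.2 h.symm
  rw [Perm.notMem_support]
  simp only [Perm.mul_apply]
  by_cases hsx : s x = x
  · rw [fix_inv s x hsx]
    have hst : s (t⁻¹ x) = t⁻¹ x := by
      by_contra h
      refine ht (t⁻¹ x) h (fun h' ↦ h ?_) (apply_inv t x)
      rw [apply_inv] at h'
      rw [← h', hsx]
    rw [hst, apply_inv]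
  · have htx : t x = x := not_not.1 (hx hsx)
    have hts : t (s⁻¹ x) = s⁻¹ x := by
      by_contra h
      refine hs (s⁻¹ x) (fun h' ↦ hsx ?_) h (apply_inv s x)
      rw [apply_inv] at h'
      exact Perm.eq_inv_iff_eq.1 h'
    rw [fix_inv t _ hts, apply_inv, htx]

/-- **Support of the commutator `[s, τ]` with `τ = σ⁻¹sσ`.**
(Stated in the right-action convention `x^{gh} = (x^g)^h` of the paper; in Mathlib's
left-action composition the word `σ⁻¹sσ` becomes the element `σ * s * σ⁻¹` and the
commutator `[s,τ] = s⁻¹τ⁻¹sτ` becomes `τ * s * τ⁻¹ * s⁻¹`, while points, supports and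
images of sets are unchanged.) With `T = supp(s)`:
`supp([s,τ]) ⊆ (T ∩ T^σ) ∪ (T ∩ T^σ)^s ∪ (T ∩ T^σ)^τ`, and consequently
`|supp([s,τ])| ≤ 3·|T ∩ T^σ|`. -/
theorem commutator_support_bound {Ω : Type*} [Fintype Ω] [DecidableEq Ω]
    (s σ τ : Perm Ω) (hτ : τ = σ * s * σ⁻¹) :
    (τ * s * τ⁻¹ * s⁻¹).support ⊆
        (s.support ∩ s.support.image ⇑σ) ∪
          (s.support ∩ s.support.image ⇑σ).image ⇑s ∪
          (s.support ∩ s.support.image ⇑σ).image ⇑τ ∧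
      (τ * s * τ⁻¹ * s⁻¹).support.card ≤ 3 * (s.support ∩ s.support.image ⇑σ).card := by
  have hsupp : s.support.image ⇑σ = τ.support := by
    rw [hτ, Perm.support_conj, Finset.map_eq_image]
    rfl
  rw [hsupp]
  refine ⟨Perm.support_commutator_subset s τ,
    (Finset.card_le_card (Perm.support_commutator_subset s τ)).trans ?_⟩
  grw [Finset.card_union_le, Finset.card_union_le, Finset.card_image_le, Finset.card_image_le]
  exact le_of_eq (by ring)
end

section
/- Let Ω be a finite set, let s, σ be permutations of Ω, and suppose there exist points y₁, y₂ ∈ Ω such that y₁ ∈ supp(s), y₂ ∉ supp(s), y₁^σ ∈ supp(s), and y₂^σ = (y₁^σ)^{s⁻¹}. Then, with τ = σ⁻¹sσ, the commutator [s,τ] = s⁻¹τ⁻¹sτ is not the identity permutation; indeed (y₁^σ)^{s⁻¹τ⁻¹sτ} ≠ y₁^σ. -/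
open Equiv

/-- **The commutator `[s, τ]` is nontrivial.**
(Stated in the right-action convention `x^{gh} = (x^g)^h` of the paper; in Mathlib's
left-action composition the word `τ = σ⁻¹sσ` becomes the element `σ * s * σ⁻¹` and the
commutator `[s,τ] = s⁻¹τ⁻¹sτ` becomes `τ * s * τ⁻¹ * s⁻¹`; the point `y^σ` is `σ y`.)
If `y₁ ∈ supp(s)`, `y₂ ∉ supp(s)`, `y₁^σ ∈ supp(s)` and `y₂^σ = (y₁^σ)^{s⁻¹}`, then
`[s,τ]` moves `y₁^σ`; in particular it is not the identity. -/
theorem commutator_ne_one {Ω : Type*} [Fintype Ω] [DecidableEq Ω]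
    (s σ τ : Perm Ω) (hτ : τ = σ * s * σ⁻¹) (y₁ y₂ : Ω)
    (h₁ : y₁ ∈ s.support) (h₂ : y₂ ∉ s.support)
    (h₃ : σ y₁ ∈ s.support) (h₄ : σ y₂ = s⁻¹ (σ y₁)) :
    (τ * s * τ⁻¹ * s⁻¹) (σ y₁) ≠ σ y₁ ∧ τ * s * τ⁻¹ * s⁻¹ ≠ 1 := by
  subst hτ
  have hs : s y₁ ≠ y₁ := Perm.mem_support.1 h₁
  have hfix : s⁻¹ y₂ = y₂ := Perm.inv_eq_iff_eq.2 (Perm.notMem_support.1 h₂).symm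
  have himage : (σ * s * σ⁻¹ * s * (σ * s * σ⁻¹)⁻¹ * s⁻¹) (σ y₁) = σ (s y₁) := by
    have hσ : σ⁻¹ (σ y₂) = y₂ := σ.symm_apply_apply y₂
    have hσ' : σ⁻¹ (σ y₁) = y₁ := σ.symm_apply_apply y₁
    have hback : s (σ y₂) = σ y₁ := h₄ ▸ s.apply_symm_apply (σ y₁)
    simp only [mul_inv_rev, inv_inv, Perm.mul_apply, ← h₄, hσ, hfix, hback, hσ']
  have hmoved : (σ * s * σ⁻¹ * s * (σ * s * σ⁻¹)⁻¹ * s⁻¹) (σ y₁) ≠ σ y₁ := by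
    rw [himage]
    exact σ.injective.ne hs
  exact ⟨hmoved, fun h => hmoved (by rw [h, Perm.one_apply])⟩
end
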